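/- Let u ∈ W^{1,2}_{loc}(ℝ^{n+1}_+) with ∇u ∈ L² on each horizontal slice, and suppose the modified non-tangential maximal function Ñ_*(∇u)(x₀) = sup_{(x,t): |x₀−x|<t} ( ⨍⨍_{|x−y|<t, |t−s|<t/2} |∇u(y,s)|² dy ds )^{1/2} belongs to L²(ℝⁿ). Suppose further u solves a divergence-form equation with t-independent coefficients so that interior Caccioppoli inequalities hold: for any ball B(X, r) ⊂ ℝ^{n+1}_+, ∫_{B(X,r)}|∇∂_s u|² ≤ Cr^{-2}∫_{B(X,2r)}|∂_s u|². Then sup_{t>0} ‖∇u(·,t)‖_{L²(ℝⁿ)} ≤ C‖Ñ_*(∇u)‖_{L²(ℝⁿ)}. -/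

import Mathlib

open MeasureTheory Set ENNReal

/-- The modified non-tangential maximal function
`Ñ_*(∇u)(x₀) = sup_{|x₀−x|<t} (⨍⨍_{|x−y|<t,|t−s|<t/2} |∇u|²)^{1/2}`. -/
noncomputable def Ntil {n : ℕ} (U : (Fin n → ℝ) × ℝ → ℂ) (x₀ : Fin n → ℝ) : ℝ≥0∞ :=
  ⨆ (x : Fin n → ℝ) (t : ℝ) (_ : 0 < t) (_ : dist x₀ x < t),
    (⨍⁻ p in (Metric.ball x t) ×ˢ Ioo (t/2) (3*t/2),
        (‖fderiv ℝ U p‖₊ : ℝ≥0∞) ^ 2 ∂volume) ^ ((1:ℝ)/2)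

lemma enorm_sub_le_aux (f : ℝ → ℂ) (a b : ℝ) (hab : a ≤ b)
    (hf : ∀ x ∈ Icc a b, DifferentiableAt ℝ f x) :
    ‖f b - f a‖ₑ ≤ ∫⁻ x in Icc a b, ‖deriv f x‖ₑ := by
  by_cases h : (∫⁻ x in Icc a b, ‖deriv f x‖ₑ) = ⊤
  · rw [h]; exact le_top
  have hi : IntegrableOn (deriv f) (Icc a b) volume :=
    ⟨(measurable_deriv f).aestronglyMeasurable, lt_top_iff_ne_top.2 h⟩
  have := intervalIntegral.integral_eq_sub_of_hasDerivAt (f := f) (f' := deriv f) (a := a) (b := b)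
    (fun x hx => (hf x (by rwa [uIcc_of_le hab] at hx)).hasDerivAt)
    ((intervalIntegrable_iff_integrableOn_Icc_of_le hab).2 hi)
  rw [← this, intervalIntegral.integral_of_le hab]
  refine (enorm_integral_le_lintegral_enorm _).trans ?_
  exact lintegral_mono_set Ioc_subset_Icc_self

lemma sq_lintegral_le (μ : Measure ℝ) (f : ℝ → ℝ≥0∞) (hf : Measurable f) :
    (∫⁻ x, f x ∂μ) ^ 2 ≤ μ univ * ∫⁻ x, f x ^ 2 ∂μ := by
  have h := ENNReal.lintegral_mul_le_Lp_mul_Lq μ Real.HolderConjugate.two_two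
    (f := f) (g := fun _ => 1) hf.aemeasurable aemeasurable_const
  simp only [Pi.mul_apply, mul_one, ENNReal.one_rpow, lintegral_const, one_mul] at h
  calc _ ≤ _ := pow_le_pow_left' h 2
    _ = _ := by
      rw [mul_pow, ← ENNReal.rpow_natCast, ← ENNReal.rpow_mul, ← ENNReal.rpow_natCast (_ ^ (1/2:ℝ)), ← ENNReal.rpow_mul]
      norm_num
      rw [mul_comm]

lemma add_sq_le_aux (a b : ℝ≥0∞) : (a + b) ^ 2 ≤ 2 * a ^ 2 + 2 * b ^ 2 := by
  induction a with
  | top => simp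
  | coe a =>
    induction b with
    | top => simp
    | coe b =>
      have : (a + b) ^ 2 ≤ 2 * (a ^ 2 + b ^ 2) := add_sq_le
      rw [mul_add] at this
      exact_mod_cast this

lemma average_aux {n : ℕ} (F : (Fin n → ℝ) × ℝ → ℝ≥0∞) (hF : Measurable F) (r : ℝ)
    (I : Set ℝ) :
    ∫⁻ z, ∫⁻ p in Metric.ball z r ×ˢ I, F p
      = volume (Metric.ball (0 : Fin n → ℝ) r) * ∫⁻ x, ∫⁻ s in I, F (x, s) := by
  have hG : Measurable (fun x : Fin n → ℝ => ∫⁻ s in I, F (x, s)) := hF.lintegral_prod_right'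
  have h1 : ∀ z : Fin n → ℝ, ∫⁻ p in Metric.ball z r ×ˢ I, F p
      = ∫⁻ x, (Metric.ball z r).indicator (fun x => ∫⁻ s in I, F (x, s)) x := by
    intro z
    rw [lintegral_indicator Metric.isOpen_ball.measurableSet, Measure.volume_eq_prod,
      ← Measure.prod_restrict, lintegral_prod _ hF.aemeasurable]
  simp_rw [h1]
  rw [lintegral_lintegral_swap]
  · have h2 : ∀ x : Fin n → ℝ, ∫⁻ z, (Metric.ball z r).indicator (fun x => ∫⁻ s in I, F (x, s)) x
        = volume (Metric.ball (0 : Fin n → ℝ) r) * ∫⁻ s in I, F (x, s) := by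
      intro x
      have : ∀ z, (Metric.ball z r).indicator (fun x => ∫⁻ s in I, F (x, s)) x
          = (Metric.ball x r).indicator (fun _ => ∫⁻ s in I, F (x, s)) z := by
        intro z
        simp only [indicator, Metric.mem_ball, dist_comm]
      simp_rw [this]
      rw [lintegral_indicator Metric.isOpen_ball.measurableSet, lintegral_const,
        Measure.restrict_apply_univ, Measure.addHaar_ball_center, mul_comm]
    simp_rw [h2]
    rw [lintegral_const_mul _ hG]
  · have : Measurable (fun p : (Fin n → ℝ) × (Fin n → ℝ) =>
        {q : (Fin n → ℝ) × (Fin n → ℝ) | dist q.2 q.1 < r}.indicator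
          (fun q => ∫⁻ s in I, F (q.2, s)) p) := by
      apply Measurable.indicator (hG.comp measurable_snd)
      exact measurableSet_lt (by fun_prop) (by fun_prop)
    exact this.aemeasurable

lemma diffquot_aux {n : ℕ} (F : (Fin n → ℝ) × ℝ → ℂ) (s : ℝ) (v : Fin n → ℝ) (hv : ‖v‖ ≤ 1)
    (hF : ∀ x, DifferentiableAt ℝ F (x, s)) (h : ℝ) (hh : 0 < h) :
    ∫⁻ x, ‖F (x + h • v, s) - F (x, s)‖ₑ ^ 2
      ≤ ENNReal.ofReal h ^ 2 * ∫⁻ x, ‖fderiv ℝ F (x, s)‖ₑ ^ 2 := by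
  have hm : Measurable (fun p : (Fin n → ℝ) × ℝ => ‖fderiv ℝ F (p.1 + p.2 • v, s)‖ₑ) :=
    ((measurable_fderiv ℝ F).comp (by fun_prop)).enorm
  have key : ∀ x, ‖F (x + h • v, s) - F (x, s)‖ₑ ^ 2
      ≤ ENNReal.ofReal h * ∫⁻ σ in Icc 0 h, ‖fderiv ℝ F (x + σ • v, s)‖ₑ ^ 2 := by
    intro x
    have hd : ∀ σ : ℝ, HasDerivAt (fun σ : ℝ => F (x + σ • v, s))
        (fderiv ℝ F (x + σ • v, s) (v, 0)) σ := by
      intro σ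
      have h1 : HasDerivAt (fun σ : ℝ => (x + σ • v, s)) (v, (0:ℝ)) σ := by
        have := ((hasDerivAt_id σ).smul_const v).const_add x
        simpa using this.prodMk (hasDerivAt_const σ s)
      exact (hF _).hasFDerivAt.comp_hasDerivAt σ h1
    have h2 := enorm_sub_le_aux (fun σ : ℝ => F (x + σ • v, s)) 0 h hh.le
      (fun σ _ => (hd σ).differentiableAt)
    simp only [zero_smul, add_zero] at h2
    have h3 : ∫⁻ σ in Icc 0 h, ‖deriv (fun σ : ℝ => F (x + σ • v, s)) σ‖ₑ
        ≤ ∫⁻ σ in Icc 0 h, ‖fderiv ℝ F (x + σ • v, s)‖ₑ := by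
      apply lintegral_mono
      intro σ
      simp only [(hd σ).deriv]
      rw [enorm_le_iff_norm_le]
      refine (ContinuousLinearMap.le_opNorm _ _).trans ?_
      refine mul_le_of_le_one_right (norm_nonneg _) ?_
      simpa [Prod.norm_def] using hv
    refine (pow_le_pow_left' (h2.trans h3) 2).trans ?_
    refine (sq_lintegral_le _ _ (hm.comp (measurable_prodMk_left (x := x)))).trans ?_
    simp
  refine (lintegral_mono key).trans ?_
  rw [lintegral_const_mul' _ _ ofReal_ne_top, lintegral_lintegral_swap (hm.pow_const 2).aemeasurable]
  have : ∀ σ : ℝ, ∫⁻ x, ‖fderiv ℝ F (x + σ • v, s)‖ₑ ^ 2 = ∫⁻ x, ‖fderiv ℝ F (x, s)‖ₑ ^ 2 :=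
    fun σ => lintegral_add_right_eq_self (fun x => ‖fderiv ℝ F (x, s)‖ₑ ^ 2) (σ • v)
  simp only [this, lintegral_const, Measure.restrict_apply_univ, Real.volume_Icc, sub_zero]
  apply le_of_eq
  ring

lemma slice_aux {n : ℕ} (f g : (Fin n → ℝ) → ℝ → ℂ) (a b t s : ℝ)
    (ht : t ∈ Ioo a b) (hs : s ∈ Ioo a b)
    (hf : ∀ x, ∀ τ ∈ Ioo a b, HasDerivAt (f x) (g x τ) τ)
    (hg : Measurable (fun p : (Fin n → ℝ) × ℝ => g p.1 p.2)) :
    ∫⁻ x, ‖f x t‖ₑ ^ 2 ≤ 2 * (∫⁻ x, ‖f x s‖ₑ ^ 2)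
      + 2 * (ENNReal.ofReal (b - a) * ∫⁻ x, ∫⁻ τ in Ioo a b, ‖g x τ‖ₑ ^ 2) := by
  have aux : ∀ x, ∀ c d, c ∈ Ioo a b → d ∈ Ioo a b → c ≤ d →
      ‖f x d - f x c‖ₑ ≤ ∫⁻ τ in Ioo a b, ‖g x τ‖ₑ := by
    intro x c d hc hd hcd
    have hsub : Icc c d ⊆ Ioo a b := fun y hy => ⟨hc.1.trans_le hy.1, hy.2.trans_lt hd.2⟩
    refine (enorm_sub_le_aux (f x) c d hcd
      (fun y hy => (hf x y (hsub hy)).differentiableAt)).trans ?_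
    rw [setLIntegral_congr_fun (g := fun τ => ‖g x τ‖ₑ) measurableSet_Icc
      (fun y hy => by simp only [(hf x y (hsub hy)).deriv])]
    exact lintegral_mono_set hsub
  have key : ∀ x, ‖f x t‖ₑ ^ 2 ≤ 2 * ‖f x s‖ₑ ^ 2 +
      2 * (ENNReal.ofReal (b - a) * ∫⁻ τ in Ioo a b, ‖g x τ‖ₑ ^ 2) := by
    intro x
    have h1 : ‖f x t - f x s‖ₑ ≤ ∫⁻ τ in Ioo a b, ‖g x τ‖ₑ := by
      rcases le_total s t with h | h
      · exact aux x s t hs ht h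
      · rw [← enorm_neg, neg_sub]; exact aux x t s ht hs h
    have h2 : ‖f x t‖ₑ ≤ ‖f x s‖ₑ + ∫⁻ τ in Ioo a b, ‖g x τ‖ₑ := by
      calc ‖f x t‖ₑ = ‖f x s + (f x t - f x s)‖ₑ := by congr 1; ring
        _ ≤ _ := (enorm_add_le _ _).trans (by gcongr)
    refine (pow_le_pow_left' h2 2).trans ((add_sq_le_aux _ _).trans ?_)
    gcongr
    refine (sq_lintegral_le _ _ ?_).trans ?_
    · exact (hg.comp (measurable_prodMk_left (x := x))).enorm
    · simp
  refine (lintegral_mono key).trans ?_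
  have hm : Measurable (fun x => ∫⁻ τ in Ioo a b, ‖g x τ‖ₑ ^ 2) :=
    (hg.enorm.pow_const 2).lintegral_prod_right'
  rw [lintegral_add_right _ ((hm.const_mul _).const_mul _), lintegral_const_mul' _ _ (by simp),
    lintegral_const_mul' _ _ (by simp), lintegral_const_mul' _ _ (by simp)]

lemma whitney_aux {n : ℕ} (U : (Fin n → ℝ) × ℝ → ℂ) (z : Fin n → ℝ) (t : ℝ) (ht : 0 < t) :
    ∫⁻ p in Metric.ball z t ×ˢ Ioo (t/2) (3*t/2), ‖fderiv ℝ U p‖ₑ ^ 2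
      ≤ ENNReal.ofReal ((2 * t) ^ n) * ENNReal.ofReal t * Ntil U z ^ 2 := by
  have hvol : volume (Metric.ball z t ×ˢ Ioo (t/2) (3*t/2))
      = ENNReal.ofReal ((2 * t) ^ n) * ENNReal.ofReal t := by
    rw [Measure.volume_eq_prod, Measure.prod_prod, Real.volume_pi_ball _ ht, Real.volume_Ioo]
    simp only [Fintype.card_fin]
    congr 2; ring
  have h1 : (⨍⁻ p in (Metric.ball z t) ×ˢ Ioo (t/2) (3*t/2),
        (‖fderiv ℝ U p‖₊ : ℝ≥0∞) ^ 2 ∂volume) ^ ((1:ℝ)/2) ≤ Ntil U z := by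
    unfold Ntil
    exact le_iSup_of_le z (le_iSup_of_le t (le_iSup_of_le ht
      (le_iSup_of_le (by simpa using ht) le_rfl)))
  have h2 := pow_le_pow_left' h1 2
  rw [← ENNReal.rpow_natCast, ← ENNReal.rpow_mul] at h2
  norm_num at h2
  rw [← hvol, ← measure_mul_setLAverage _ (by rw [hvol]; finiteness)]
  gcongr
  exact h2

lemma stripU_aux {n : ℕ} (U : (Fin n → ℝ) × ℝ → ℂ) (t : ℝ) (ht : 0 < t) :
    ∫⁻ x, ∫⁻ s in Ioo (3*t/4) (5*t/4), ‖fderiv ℝ U (x, s)‖ₑ ^ 2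
      ≤ ENNReal.ofReal t * ∫⁻ z, Ntil U z ^ 2 := by
  have h := average_aux (fun p => ‖fderiv ℝ U p‖ₑ ^ 2) ((measurable_fderiv ℝ U).enorm.pow_const 2)
    t (Ioo (3*t/4) (5*t/4))
  have h2 : ∫⁻ z, ∫⁻ p in Metric.ball z t ×ˢ Ioo (3*t/4) (5*t/4), ‖fderiv ℝ U p‖ₑ ^ 2
      ≤ ∫⁻ z, ENNReal.ofReal ((2 * t) ^ n) * ENNReal.ofReal t * Ntil U z ^ 2 := by
    refine lintegral_mono (fun z => le_trans ?_ (whitney_aux U z t ht))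
    apply lintegral_mono_set
    apply prod_mono_right
    apply Ioo_subset_Ioo <;> linarith
  rw [h, lintegral_const_mul' _ _ (by finiteness), mul_assoc, Real.volume_pi_ball _ ht,
    Fintype.card_fin] at h2
  refine (ENNReal.mul_le_mul_iff_right ?_ (by finiteness)).1 h2
  simp only [ne_eq, ENNReal.ofReal_eq_zero, not_le]
  positivity

lemma stripV_aux {n : ℕ} (C : ℝ) (U : (Fin n → ℝ) × ℝ → ℂ)
    (hCac : ∀ (X : (Fin n → ℝ) × ℝ) (r : ℝ), 0 < r →
        Metric.ball X (2*r) ⊆ {p : (Fin n → ℝ) × ℝ | 0 < p.2} →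
        (∫⁻ p in Metric.ball X r,
            (‖fderiv ℝ (fun q => fderiv ℝ U q ((0 : Fin n → ℝ), (1:ℝ))) p‖₊ : ℝ≥0∞) ^ 2)
          ≤ ENNReal.ofReal (C / r ^ 2) *
            ∫⁻ p in Metric.ball X (2*r),
              (‖fderiv ℝ U p ((0 : Fin n → ℝ), (1:ℝ))‖₊ : ℝ≥0∞) ^ 2)
    (t : ℝ) (ht : 0 < t) :
    ∫⁻ x, ∫⁻ s in Ioo (3*t/4) (5*t/4),
        ‖fderiv ℝ (fun q => fderiv ℝ U q ((0 : Fin n → ℝ), (1:ℝ))) (x, s)‖ₑ ^ 2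
      ≤ ENNReal.ofReal (C / (t/4) ^ 2) * ENNReal.ofReal (4 ^ n * t) * ∫⁻ z, Ntil U z ^ 2 := by
  have h := average_aux
    (fun p => ‖fderiv ℝ (fun q => fderiv ℝ U q ((0 : Fin n → ℝ), (1:ℝ))) p‖ₑ ^ 2)
    ((measurable_fderiv ℝ _).enorm.pow_const 2) (t/4) (Ioo (3*t/4) (5*t/4))
  have h2 : ∫⁻ z, ∫⁻ p in Metric.ball z (t/4) ×ˢ Ioo (3*t/4) (5*t/4),
        ‖fderiv ℝ (fun q => fderiv ℝ U q ((0 : Fin n → ℝ), (1:ℝ))) p‖ₑ ^ 2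
      ≤ ∫⁻ z, ENNReal.ofReal (C / (t/4) ^ 2) *
        (ENNReal.ofReal ((2 * t) ^ n) * ENNReal.ofReal t) * Ntil U z ^ 2 := by
    refine lintegral_mono (fun z => ?_)
    have e1 : Metric.ball z (t/4) ×ˢ Ioo (3*t/4) (5*t/4) = Metric.ball (z, t) (t/4) := by
      rw [← ball_prod_same, Real.ball_eq_Ioo]
      congr 2 <;> ring
    have e2 : Metric.ball (z, t) (2 * (t/4)) ⊆ Metric.ball z t ×ˢ Ioo (t/2) (3*t/2) := by
      rw [← ball_prod_same, Real.ball_eq_Ioo]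
      apply prod_mono
      · apply Metric.ball_subset_ball; linarith
      · apply Ioo_subset_Ioo <;> linarith
    simp only [e1, mul_assoc]
    refine (hCac (z, t) (t/4) (by positivity) ?_).trans ?_
    · intro p hp
      have := (e2 hp).2.1
      simp only [mem_ofPred_eq]
      linarith
    · gcongr
      rw [← mul_assoc]
      refine le_trans ?_ (whitney_aux U z t ht)
      refine (lintegral_mono_set e2).trans ?_
      apply lintegral_mono
      intro p
      refine pow_le_pow_left' ?_ 2
      change ‖fderiv ℝ U p ((0 : Fin n → ℝ), (1:ℝ))‖ₑ ≤ ‖fderiv ℝ U p‖ₑ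
      rw [enorm_le_iff_norm_le]
      refine (ContinuousLinearMap.le_opNorm _ _).trans ?_
      simp [Prod.norm_def]
  rw [h, lintegral_const_mul' _ _ (by finiteness), Real.volume_pi_ball _ (by positivity),
    Fintype.card_fin] at h2
  have h0 : ENNReal.ofReal ((2 * (t / 4)) ^ n) ≠ 0 := by
    simp only [ne_eq, ENNReal.ofReal_eq_zero, not_le]
    positivity
  refine (ENNReal.mul_le_mul_iff_right h0 (by finiteness)).1 (h2.trans (le_of_eq ?_))
  have e3 : (2 * t) ^ n = (2 * (t/4)) ^ n * 4 ^ n := by rw [← mul_pow]; ring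
  rw [e3, ENNReal.ofReal_mul (by positivity), ENNReal.ofReal_mul (p := 4 ^ n) (by positivity)]
  ring

lemma combine_aux (A : ℝ → ℝ≥0∞) (G B K : ℝ≥0∞) (C t : ℝ) (m : ℕ) (hC : 0 < C) (ht : 0 < t)
    (h : ∀ s ∈ Ioo (3*t/4) (5*t/4),
      G ≤ 2 * A s + 2 * (ENNReal.ofReal (5*t/4 - 3*t/4) * B))
    (hA : ∫⁻ s in Ioo (3*t/4) (5*t/4), A s ≤ ENNReal.ofReal t * K)
    (hB : B ≤ ENNReal.ofReal (C / (t/4) ^ 2) * ENNReal.ofReal (4 ^ m * t) * K) :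
    G ≤ ENNReal.ofReal (4 + 16 * C * 4 ^ m) * K := by
  have hv : volume (Ioo (3*t/4) (5*t/4)) = ENNReal.ofReal (t/2) := by
    rw [Real.volume_Ioo]; congr 1; ring
  have ht2 : 5*t/4 - 3*t/4 = t/2 := by ring
  rw [ht2] at h
  have h1 : ENNReal.ofReal (t/2) * G ≤ ENNReal.ofReal (t/2) * (ENNReal.ofReal (4 + 16 * C * 4 ^ m) * K) := by
    calc ENNReal.ofReal (t/2) * G = ∫⁻ s in Ioo (3*t/4) (5*t/4), G := by
          rw [setLIntegral_const, hv, mul_comm]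
      _ ≤ ∫⁻ s in Ioo (3*t/4) (5*t/4), (2 * A s + 2 * (ENNReal.ofReal (t/2) * B)) :=
          setLIntegral_mono' measurableSet_Ioo h
      _ = 2 * (∫⁻ s in Ioo (3*t/4) (5*t/4), A s)
            + 2 * (ENNReal.ofReal (t/2) * B) * ENNReal.ofReal (t/2) := by
          rw [lintegral_add_right _ measurable_const, lintegral_const_mul' _ _ (by simp),
            setLIntegral_const, hv]
      _ ≤ 2 * (ENNReal.ofReal t * K) + 2 * (ENNReal.ofReal (t/2) *
            (ENNReal.ofReal (C / (t/4) ^ 2) * ENNReal.ofReal (4 ^ m * t) * K))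
            * ENNReal.ofReal (t/2) := by gcongr
      _ = (ENNReal.ofReal 2 * ENNReal.ofReal t + ENNReal.ofReal 2 * (ENNReal.ofReal (t/2) *
            (ENNReal.ofReal (C / (t/4) ^ 2) * ENNReal.ofReal (4 ^ m * t)))
            * ENNReal.ofReal (t/2)) * K := by
          rw [show ENNReal.ofReal 2 = 2 by simp]; ring
      _ = _ := by
          rw [← mul_assoc (ENNReal.ofReal (t/2)) _ K]
          congr 1
          rw [← ENNReal.ofReal_mul (by positivity), ← ENNReal.ofReal_mul (by positivity),
            ← ENNReal.ofReal_mul (by positivity), ← ENNReal.ofReal_mul (by positivity),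
            ← ENNReal.ofReal_mul (by positivity), ← ENNReal.ofReal_mul (by positivity),
            ← ENNReal.ofReal_add (by positivity) (by positivity)]
          congr 1
          field_simp
          ring
  refine (ENNReal.mul_le_mul_iff_right ?_ (by finiteness)).1 h1
  simp only [ne_eq, ENNReal.ofReal_eq_zero, not_le]
  positivity

lemma diffquot_aux' {n : ℕ} (F : (Fin n → ℝ) × ℝ → ℂ) (s : ℝ) (v : Fin n → ℝ) (hv : ‖v‖ ≤ 1)
    (hF : ∀ x, DifferentiableAt ℝ F (x, s)) (h : ℝ) (hh : 0 < h) :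
    ∫⁻ x, ‖h⁻¹ • (F (x + h • v, s) - F (x, s))‖ₑ ^ 2
      ≤ ∫⁻ x, ‖fderiv ℝ F (x, s)‖ₑ ^ 2 := by
  have h1 := diffquot_aux F s v hv hF h hh
  have h0 : ENNReal.ofReal h ≠ 0 := by simpa using hh
  have e : ‖h⁻¹‖ₑ = (ENNReal.ofReal h)⁻¹ := by
    rw [Real.enorm_eq_ofReal (by positivity), ENNReal.ofReal_inv_of_pos hh]
  simp only [enorm_smul, mul_pow, e]
  rw [lintegral_const_mul' _ _ (by simpa using hh)]
  calc _ ≤ (ENNReal.ofReal h)⁻¹ ^ 2 *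
        (ENNReal.ofReal h ^ 2 * ∫⁻ x, ‖fderiv ℝ F (x, s)‖ₑ ^ 2) := by gcongr
    _ = _ := by
      rw [← mul_assoc, ← mul_pow, ENNReal.inv_mul_cancel h0 ofReal_ne_top, one_pow, one_mul]

lemma hasDerivAt_vert {n : ℕ} (F : (Fin n → ℝ) × ℝ → ℂ) (x : Fin n → ℝ) (τ : ℝ)
    (hF : DifferentiableAt ℝ F (x, τ)) :
    HasDerivAt (fun τ => F (x, τ)) (fderiv ℝ F (x, τ) ((0 : Fin n → ℝ), (1:ℝ))) τ := by
  have h1 : HasDerivAt (fun τ : ℝ => (x, τ)) ((0 : Fin n → ℝ), (1:ℝ)) τ :=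
    (hasDerivAt_const τ x).prodMk (hasDerivAt_id τ)
  exact hF.hasFDerivAt.comp_hasDerivAt τ h1

lemma main_aux {n : ℕ} (C : ℝ) (hC : 0 < C) (U V : (Fin n → ℝ) × ℝ → ℂ)
    (hVdef : V = fun q => fderiv ℝ U q ((0 : Fin n → ℝ), (1:ℝ)))
    (hU : ∀ p : (Fin n → ℝ) × ℝ, 0 < p.2 → DifferentiableAt ℝ U p)
    (hV : ∀ p : (Fin n → ℝ) × ℝ, 0 < p.2 → DifferentiableAt ℝ V p)
    (t : ℝ) (ht : 0 < t) (K : ℝ≥0∞)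
    (hA : ∫⁻ x, ∫⁻ s in Ioo (3*t/4) (5*t/4), ‖fderiv ℝ U (x, s)‖ₑ ^ 2 ≤ ENNReal.ofReal t * K)
    (hB : ∫⁻ x, ∫⁻ s in Ioo (3*t/4) (5*t/4), ‖fderiv ℝ V (x, s)‖ₑ ^ 2
      ≤ ENNReal.ofReal (C / (t/4) ^ 2) * ENNReal.ofReal (4 ^ n * t) * K) :
    (∫⁻ x, ‖V (x, t)‖ₑ ^ 2 ≤ ENNReal.ofReal (4 + 16 * C * 4 ^ n) * K) ∧
    (∀ v : Fin n → ℝ, ‖v‖ ≤ 1 →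
      ∫⁻ x, ‖fderiv ℝ U (x, t) (v, 0)‖ₑ ^ 2 ≤ ENNReal.ofReal (4 + 16 * C * 4 ^ n) * K) := by
  have hVm : Measurable V := by rw [hVdef]; exact measurable_fderiv_apply_const ℝ U _
  have htI : t ∈ Ioo (3*t/4) (5*t/4) := by constructor <;> linarith
  have hpos : ∀ s ∈ Ioo (3*t/4) (5*t/4), 0 < s := fun s hs => by
    have := hs.1
    linarith
  have hop : ∀ (L : (Fin n → ℝ) × ℝ →L[ℝ] ℂ), ‖L (0, 1)‖ₑ ≤ ‖L‖ₑ := by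
    intro L
    rw [enorm_le_iff_norm_le]
    refine (ContinuousLinearMap.le_opNorm _ _).trans ?_
    simp [Prod.norm_def]
  have hA' : ∫⁻ s in Ioo (3*t/4) (5*t/4), ∫⁻ x, ‖fderiv ℝ U (x, s)‖ₑ ^ 2
      ≤ ENNReal.ofReal t * K := by
    rw [lintegral_lintegral_swap] at hA
    · exact hA
    · exact ((measurable_fderiv ℝ U).enorm.pow_const 2).aemeasurable
  constructor
  · refine combine_aux (fun s => ∫⁻ x, ‖fderiv ℝ U (x, s)‖ₑ ^ 2) _ _ K C t n hC ht ?_ hA' hB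
    intro s hs
    refine (slice_aux (fun x τ => V (x, τ))
      (fun x τ => fderiv ℝ V (x, τ) ((0 : Fin n → ℝ), (1:ℝ))) _ _ t s htI hs
      (fun x τ hτ => hasDerivAt_vert V x τ (hV _ (hpos τ hτ)))
      (measurable_fderiv_apply_const ℝ V _)).trans ?_
    gcongr with x x τ
    · rw [hVdef]; exact hop _
    · exact hop _
  · intro v hv
    have hq : ∀ h : ℝ, 0 < h → ∫⁻ x, ‖h⁻¹ • (U (x + h • v, t) - U (x, t))‖ₑ ^ 2
        ≤ ENNReal.ofReal (4 + 16 * C * 4 ^ n) * K := by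
      intro h hh
      refine combine_aux (fun s => ∫⁻ x, ‖fderiv ℝ U (x, s)‖ₑ ^ 2) _ _ K C t n hC ht ?_ hA' hB
      intro s hs
      have hgm : Measurable (fun p : (Fin n → ℝ) × ℝ =>
          h⁻¹ • (V (p.1 + h • v, p.2) - V (p.1, p.2))) :=
        ((hVm.comp (by fun_prop)).sub (hVm.comp (by fun_prop))).const_smul h⁻¹
      refine (slice_aux (fun x τ => h⁻¹ • (U (x + h • v, τ) - U (x, τ)))
        (fun x τ => h⁻¹ • (V (x + h • v, τ) - V (x, τ))) _ _ t s htI hs ?_ hgm).trans ?_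
      · intro x τ hτ
        have h1 := hasDerivAt_vert U (x + h • v) τ (hU _ (hpos τ hτ))
        have h2 := hasDerivAt_vert U x τ (hU _ (hpos τ hτ))
        rw [hVdef]
        exact (h1.sub h2).const_smul h⁻¹
      · gcongr 2 * ?_ + 2 * (_ * ?_)
        · exact diffquot_aux' U s v hv (fun x => hU _ (hpos s hs)) h hh
        · rw [lintegral_lintegral_swap (hgm.enorm.pow_const 2).aemeasurable,
            lintegral_lintegral_swap
              (f := fun x s => ‖fderiv ℝ V (x, s)‖ₑ ^ 2)
              ((measurable_fderiv ℝ V).enorm.pow_const 2).aemeasurable]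
          apply setLIntegral_mono' measurableSet_Ioo
          intro τ hτ
          exact diffquot_aux' V τ v hv (fun x => hV _ (hpos τ hτ)) h hh
    have hUc : Continuous (fun x : Fin n → ℝ => U (x, t)) := by
      rw [continuous_iff_continuousAt]
      intro x
      exact (hU (x, t) ht).continuousAt.comp (f := fun x : Fin n → ℝ => (x, t)) (by fun_prop)
    have hlim : ∀ x, Filter.Tendsto (fun k : ℕ => ‖(1 / ((k:ℝ) + 1))⁻¹ •
        (U (x + (1 / ((k:ℝ) + 1)) • v, t) - U (x, t))‖ₑ ^ 2) Filter.atTop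
        (nhds (‖fderiv ℝ U (x, t) (v, 0)‖ₑ ^ 2)) := by
      intro x
      have hd : HasDerivAt (fun σ : ℝ => U (x + σ • v, t)) (fderiv ℝ U (x, t) (v, 0)) 0 := by
        have h1 : HasDerivAt (fun σ : ℝ => (x + σ • v, t)) (v, (0:ℝ)) 0 := by
          have := ((hasDerivAt_id (0:ℝ)).smul_const v).const_add x
          simpa using this.prodMk (hasDerivAt_const (0:ℝ) t)
        have h2 : HasFDerivAt U (fderiv ℝ U (x, t)) (x + (0:ℝ) • v, t) := by
          simpa using (hU (x, t) ht).hasFDerivAt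
        exact h2.comp_hasDerivAt (0:ℝ) h1
      have h3 := hd.tendsto_slope_zero
      have h4 : Filter.Tendsto (fun k : ℕ => 1 / ((k:ℝ) + 1)) Filter.atTop (nhdsWithin 0 {0}ᶜ) := by
        refine tendsto_nhdsWithin_iff.2 ⟨tendsto_one_div_add_atTop_nhds_zero_nat, ?_⟩
        refine Filter.Eventually.of_forall fun k => ?_
        have : (0:ℝ) < 1 / ((k:ℝ) + 1) := by positivity
        exact this.ne'
      have h5 := h3.comp h4
      simp only [zero_add, zero_smul, add_zero] at h5
      exact (ENNReal.continuous_pow 2).continuousAt.tendsto.comp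
        (continuous_enorm.continuousAt.tendsto.comp h5)
    calc ∫⁻ x, ‖fderiv ℝ U (x, t) (v, 0)‖ₑ ^ 2
        = ∫⁻ x, Filter.liminf (fun k : ℕ => ‖(1 / ((k:ℝ) + 1))⁻¹ •
        (U (x + (1 / ((k:ℝ) + 1)) • v, t) - U (x, t))‖ₑ ^ 2) Filter.atTop := by
          congr 1; ext x; exact (hlim x).liminf_eq.symm
      _ ≤ Filter.liminf (fun k : ℕ => ∫⁻ x, ‖(1 / ((k:ℝ) + 1))⁻¹ •
        (U (x + (1 / ((k:ℝ) + 1)) • v, t) - U (x, t))‖ₑ ^ 2) Filter.atTop := by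
          apply lintegral_liminf_le
          intro k
          have : Continuous (fun x : Fin n → ℝ => (1 / ((k:ℝ) + 1))⁻¹ •
            (U (x + (1 / ((k:ℝ) + 1)) • v, t) - U (x, t))) :=
            ((hUc.comp (g := fun x : Fin n → ℝ => U (x, t))
              (f := fun x : Fin n → ℝ => x + (1 / ((k:ℝ) + 1)) • v) (by fun_prop)).sub hUc).const_smul (1 / ((k:ℝ) + 1))⁻¹
          exact this.measurable.enorm.pow_const 2
      _ ≤ _ := by
          refine Filter.liminf_le_of_frequently_le' ?_
          exact Filter.Frequently.of_forall fun k => hq _ (by positivity)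

lemma opNorm_aux {n : ℕ} (L : (Fin n → ℝ) × ℝ →L[ℝ] ℂ) :
    ‖L‖ₑ ^ 2 ≤ 2 * ‖L (0, 1)‖ₑ ^ 2 + 2 * (n * ∑ i, ‖L (Pi.single i 1, 0)‖ₑ ^ 2) := by
  have h1 : ‖L‖ ≤ ‖L (0, 1)‖ + ∑ i, ‖L (Pi.single i 1, 0)‖ := by
    refine ContinuousLinearMap.opNorm_le_bound _ (by positivity) ?_
    rintro ⟨x, s⟩
    have e : (x, s) = s • ((0 : Fin n → ℝ), (1:ℝ)) + ∑ i, x i • ((Pi.single i 1 : Fin n → ℝ), (0:ℝ)) := by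
      ext j
      · simp [Prod.fst_sum, Finset.sum_apply, Pi.single_apply]
      · simp [Prod.snd_sum]
    have hs : ‖s‖ ≤ ‖(x, s)‖ := norm_snd_le (x, s)
    have hx : ∀ i, ‖x i‖ ≤ ‖(x, s)‖ := fun i => (norm_le_pi_norm x i).trans (norm_fst_le (x, s))
    calc ‖L (x, s)‖ = ‖s • L (0, 1) + ∑ i, x i • L (Pi.single i 1, 0)‖ := by
          conv_lhs => rw [e]
          simp only [map_add, map_sum, map_smul]
      _ ≤ ‖s‖ * ‖L (0, 1)‖ + ∑ i, ‖x i‖ * ‖L (Pi.single i 1, 0)‖ := by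
          refine (norm_add_le _ _).trans ?_
          rw [norm_smul]
          gcongr
          refine (norm_sum_le _ _).trans (le_of_eq ?_)
          simp only [norm_smul]
      _ ≤ ‖(x, s)‖ * ‖L (0, 1)‖ + ∑ i, ‖(x, s)‖ * ‖L (Pi.single i 1, 0)‖ := by
          gcongr with i
          exact hx i
      _ = _ := by rw [← Finset.mul_sum]; ring
  have h2 : ‖L‖ₑ ≤ ‖L (0, 1)‖ₑ + ∑ i, ‖L (Pi.single i 1, 0)‖ₑ := by
    have h1' : ‖L‖₊ ≤ ‖L (0, 1)‖₊ + ∑ i, ‖L (Pi.single i 1, 0)‖₊ := by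
      rw [← NNReal.coe_le_coe]
      push_cast
      exact h1
    simp only [enorm_eq_nnnorm]
    exact_mod_cast h1'
  refine (pow_le_pow_left' h2 2).trans ((add_sq_le_aux _ _).trans ?_)
  gcongr
  have h3 : (∑ i, ‖L (Pi.single i 1, 0)‖₊) ^ 2 ≤ (n : NNReal) * ∑ i, ‖L (Pi.single i 1, 0)‖₊ ^ 2 := by
    simpa using sq_sum_le_card_mul_sum_sq (s := Finset.univ)
      (f := fun i : Fin n => ‖L (Pi.single i 1, 0)‖₊)
  simp only [enorm_eq_nnnorm]
  exact_mod_cast h3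

/-- If `Ñ_*(∇u) ∈ L²(ℝⁿ)` and interior Caccioppoli inequalities hold, then the slice
norms are uniformly bounded: `sup_{t>0} ‖∇u(·,t)‖₂ ≤ C‖Ñ_*(∇u)‖₂`. -/
theorem stmt13 {n : ℕ} (hn : 1 ≤ n) (C : ℝ) (hC : 0 < C) :
    ∃ C' : ℝ, 0 < C' ∧
      ∀ (U : (Fin n → ℝ) × ℝ → ℂ),
      (∀ p : (Fin n → ℝ) × ℝ, 0 < p.2 → DifferentiableAt ℝ U p) →
      (∀ p : (Fin n → ℝ) × ℝ, 0 < p.2 →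
        DifferentiableAt ℝ (fun q => fderiv ℝ U q ((0 : Fin n → ℝ), (1:ℝ))) p) →
      -- ∇u ∈ L² on horizontal slices
      (∀ t > (0:ℝ), (∫⁻ x, (‖fderiv ℝ U (x, t)‖₊ : ℝ≥0∞) ^ 2) < ⊤) →
      -- interior Caccioppoli inequality for ∂_s u
      (∀ (X : (Fin n → ℝ) × ℝ) (r : ℝ), 0 < r →
        Metric.ball X (2*r) ⊆ {p : (Fin n → ℝ) × ℝ | 0 < p.2} →
        (∫⁻ p in Metric.ball X r,
            (‖fderiv ℝ (fun q => fderiv ℝ U q ((0 : Fin n → ℝ), (1:ℝ))) p‖₊ : ℝ≥0∞) ^ 2)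
          ≤ ENNReal.ofReal (C / r ^ 2) *
            ∫⁻ p in Metric.ball X (2*r),
              (‖fderiv ℝ U p ((0 : Fin n → ℝ), (1:ℝ))‖₊ : ℝ≥0∞) ^ 2) →
      -- Ñ_*(∇u) ∈ L²
      (∫⁻ x₀, (Ntil U x₀) ^ 2) < ⊤ →
      ∀ t > (0:ℝ),
        (∫⁻ x, (‖fderiv ℝ U (x, t)‖₊ : ℝ≥0∞) ^ 2) ≤
          ENNReal.ofReal C' * ∫⁻ x₀, (Ntil U x₀) ^ 2 := by
  refine ⟨(2 + 2 * n * n) * (4 + 16 * C * 4 ^ n), by positivity, ?_⟩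
  intro U hU hV _ hCac _ t ht
  have hA := stripU_aux U t ht
  have hB := stripV_aux C U hCac t ht
  obtain ⟨h1, h2⟩ := main_aux C hC U _ rfl hU hV t ht _ hA hB
  set K := ∫⁻ x₀, (Ntil U x₀) ^ 2
  have hm : ∀ w, Measurable (fun x : Fin n → ℝ => ‖fderiv ℝ U (x, t) w‖ₑ ^ 2) := fun w =>
    ((measurable_fderiv_apply_const ℝ U w).comp (by fun_prop)).enorm.pow_const 2
  have e : ENNReal.ofReal ((2 + 2 * n * n) * (4 + 16 * C * 4 ^ n))
      = (2 + 2 * n * n) * ENNReal.ofReal (4 + 16 * C * 4 ^ n) := by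
    rw [ENNReal.ofReal_mul (by positivity)]
    congr 1
    have : ((2:ℝ) + 2 * n * n) = ((2 + 2 * n * n : ℕ) : ℝ) := by push_cast; ring
    rw [this, ENNReal.ofReal_natCast]
    push_cast; ring
  calc (∫⁻ x, (‖fderiv ℝ U (x, t)‖₊ : ℝ≥0∞) ^ 2)
      ≤ ∫⁻ x, (2 * ‖fderiv ℝ U (x, t) (0, 1)‖ₑ ^ 2 +
          2 * (n * ∑ i, ‖fderiv ℝ U (x, t) (Pi.single i 1, 0)‖ₑ ^ 2)) :=
        lintegral_mono fun x => opNorm_aux _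
    _ = 2 * (∫⁻ x, ‖fderiv ℝ U (x, t) (0, 1)‖ₑ ^ 2) +
          2 * (n * ∑ i, ∫⁻ x, ‖fderiv ℝ U (x, t) (Pi.single i 1, 0)‖ₑ ^ 2) := by
        rw [lintegral_add_left ((hm _).const_mul 2), lintegral_const_mul' _ _ (by simp),
          lintegral_const_mul' _ _ (by simp), lintegral_const_mul' _ _ (by simp),
          lintegral_finsetSum _ (fun i _ => hm _)]
    _ ≤ 2 * (ENNReal.ofReal (4 + 16 * C * 4 ^ n) * K) +
          2 * (n * ∑ i : Fin n, (ENNReal.ofReal (4 + 16 * C * 4 ^ n) * K)) := by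
        gcongr with i
        exact h2 _ (by simp [Pi.norm_single])
    _ = _ := by
        rw [e, Finset.sum_const, Finset.card_univ, Fintype.card_fin, nsmul_eq_mul]
        ring
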